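/- arXiv:2008.07918 — 2 statements merged into one kernel-verified Lean document; each statement's English description precedes it below -/
import Mathlib

section
/- Let L, K be positive integers, let G be a real L×K matrix, let p > 0, let N be a symmetric positive definite real L×L matrix, and let c ∈ ℝ^K. For ρ ∈ ℝ^L define f(ρ) = p‖Gᵀρ − c‖² + ρᵀNρ, and let ρ* = p·(p·GGᵀ + N)⁻¹ G c. Then the matrix (1/p)·I_K + GᵀN⁻¹G is invertible and the minimum effective noise power satisfies f(ρ*) = cᵀ((1/p)·I_K + GᵀN⁻¹G)⁻¹ c. -/
open Matrix

/-- **Closed form of the minimized uplink effective noise power.**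
With `f ρ = p‖Gᵀρ − c‖² + ρᵀNρ` (squared Euclidean norm written as `v ⬝ᵥ v`) and
`ρ* = p·(p·GGᵀ + N)⁻¹ G c`, the matrix `(1/p)·I_K + GᵀN⁻¹G` is invertible and
`f ρ* = cᵀ((1/p)·I_K + GᵀN⁻¹G)⁻¹ c`. -/
theorem uplink_mmse_closed_form
    (L K : ℕ) (hL : 0 < L) (hK : 0 < K)
    (G : Matrix (Fin L) (Fin K) ℝ) (p : ℝ) (hp : 0 < p)
    (N : Matrix (Fin L) (Fin L) ℝ) (hN : N.PosDef)
    (c : Fin K → ℝ)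
    (f : (Fin L → ℝ) → ℝ)
    (hf : ∀ ρ : Fin L → ℝ,
      f ρ = p * ((G.transpose.mulVec ρ - c) ⬝ᵥ (G.transpose.mulVec ρ - c))
            + ρ ⬝ᵥ N.mulVec ρ) :
    IsUnit ((1 / p) • (1 : Matrix (Fin K) (Fin K) ℝ) + G.transpose * N⁻¹ * G) ∧
      f (p • ((p • (G * G.transpose) + N)⁻¹.mulVec (G.mulVec c))) =
        c ⬝ᵥ ((1 / p) • (1 : Matrix (Fin K) (Fin K) ℝ)
              + G.transpose * N⁻¹ * G)⁻¹.mulVec c := by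
  have hNu : IsUnit N.det := (isUnit_iff_isUnit_det N).mp hN.isUnit
  have hS : ((1 / p) • (1 : Matrix (Fin K) (Fin K) ℝ) + Gᵀ * N⁻¹ * G).PosDef := by
    refine (PosDef.one.smul (one_div_pos.mpr hp)).add_posSemidef ?_
    simpa only [conjTranspose_eq_transpose_of_trivial] using
      hN.inv.posSemidef.conjTranspose_mul_mul_same G
  have hA : (p • (G * Gᵀ) + N).PosDef := by
    refine PosDef.posSemidef_add ?_ hN
    simpa only [conjTranspose_eq_transpose_of_trivial] using
      (posSemidef_self_mul_conjTranspose G).smul hp.le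
  have hAu := (isUnit_iff_isUnit_det _).mp hA.isUnit
  refine ⟨hS.isUnit, ?_⟩
  obtain ⟨u, hu⟩ : ∃ u, u = ((1 / p) • (1 : Matrix (Fin K) (Fin K) ℝ)
      + Gᵀ * N⁻¹ * G)⁻¹ *ᵥ c := ⟨_, rfl⟩
  obtain ⟨ρ, hρ⟩ : ∃ ρ, ρ = N⁻¹ *ᵥ (G *ᵥ u) := ⟨_, rfl⟩
  have hc : c = (1 / p) • u + Gᵀ *ᵥ ρ := by
    have h := congrArg
      (((1 / p) • (1 : Matrix (Fin K) (Fin K) ℝ) + Gᵀ * N⁻¹ * G) *ᵥ ·) hu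
    simp only [mulVec_mulVec, mul_nonsing_inv _ ((isUnit_iff_isUnit_det _).mp hS.isUnit),
      one_mulVec] at h
    rw [← h, hρ, add_mulVec, smul_mulVec, one_mulVec, mulVec_mulVec, mulVec_mulVec]
  have hNρ : N *ᵥ ρ = G *ᵥ u := by
    rw [hρ, mulVec_mulVec, mul_nonsing_inv _ hNu, one_mulVec]
  have hAρ : (p • (G * Gᵀ) + N) *ᵥ ρ = p • (G *ᵥ c) := by
    rw [hc, add_mulVec, hNρ, mulVec_add, mulVec_smul, smul_add, smul_smul,
      mul_one_div_cancel hp.ne', one_smul, smul_mulVec, mulVec_mulVec, add_comm]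
  have hopt : p • ((p • (G * Gᵀ) + N)⁻¹ *ᵥ (G *ᵥ c)) = ρ := by
    rw [← mulVec_smul, ← hAρ, mulVec_mulVec, nonsing_inv_mul _ hAu, one_mulVec]
  have hres : Gᵀ *ᵥ ρ - c = -((1 / p) • u) := by
    rw [hc]; abel
  have hquad : ρ ⬝ᵥ (G *ᵥ u) = (Gᵀ *ᵥ ρ) ⬝ᵥ u := by
    rw [dotProduct_mulVec, mulVec_transpose]
  rw [hopt, hf, hres, hNρ, hquad, ← hu]
  conv_rhs => rw [hc]
  simp only [neg_dotProduct_neg, smul_dotProduct, dotProduct_smul, add_dotProduct, smul_eq_mul]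
  field_simp
end

section
/- Let M be a positive integer, K = 2M, let σ : Fin K → Fin K be a fixed-point-free involution (σ ∘ σ = id and σ(k) ≠ k for all k), and let W be a real M×K matrix such that: every entry of W is 0 or 1; every column of W sums to 1; every row of W sums to 2; and W_{m,k} = W_{m,σ(k)} for all m, k. Let A be an invertible real M×M matrix. Then for every s : Fin K → ℝ and every k ∈ Fin K, ((Wᵀ·A⁻¹)·(A·W)·s)_k − s_k = s_{σ(k)}. -/
open Matrix

/-- A nonnegative function vanishes off any finset that already carries its whole sum. -/
lemma eq_zero_of_sum_eq_sum_univ {ι : Type*} [Fintype ι] {f : ι → ℝ} (hf : ∀ i, 0 ≤ f i)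
    {t : Finset ι} (h : ∑ i ∈ t, f i = ∑ i, f i) {j : ι} (hj : j ∉ t) : f j = 0 := by
  classical
  have hsum : ∑ i ∈ tᶜ, f i = 0 := by
    have := Finset.sum_add_sum_compl t f
    linarith
  exact (Finset.sum_eq_zero_iff_of_nonneg fun i _ => hf i).1 hsum j (Finset.mem_compl.2 hj)

/-- The Gram matrix of a pairing matrix sends `s` to the sum of the two codewords of each pair. -/
lemma transpose_mul_self_mulVec_of_pairing {m n : Type*} [Fintype m] [Fintype n]
    {σ : n → n} (hσ : ∀ k, σ k ≠ k) {W : Matrix m n ℝ}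
    (hW : ∀ i k, W i k = 0 ∨ W i k = 1) (hcol : ∀ k, ∑ i, W i k = 1)
    (hrow : ∀ i, ∑ k, W i k = 2) (hpair : ∀ i k, W i k = W i (σ k)) (s : n → ℝ) (k : n) :
    ((Wᵀ * W) *ᵥ s) k = s k + s (σ k) := by
  classical
  have hnn : ∀ i k, 0 ≤ W i k := fun i k => by rcases hW i k with h | h <;> simp [h]
  obtain ⟨i, hi⟩ : ∃ i, W i k = 1 := by
    by_contra! h
    have hzero : ∀ i, W i k = 0 := fun i => (hW i k).resolve_right (h i)
    simpa [hzero] using hcol k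
  have hi' : W i (σ k) = 1 := hpair i k ▸ hi
  have hcol0 : ∀ j, j ≠ i → W j k = 0 := fun j hj =>
    eq_zero_of_sum_eq_sum_univ (f := fun j => W j k) (fun j => hnn j k) (t := {i})
      (by simp [hi, hcol]) (by simpa using hj)
  have hrow0 : ∀ l, l ∉ ({k, σ k} : Finset n) → W i l = 0 := fun l hl =>
    eq_zero_of_sum_eq_sum_univ (hnn i)
      (by rw [Finset.sum_pair (hσ k).symm, hi, hi', hrow]; norm_num) hl
  calc ((Wᵀ * W) *ᵥ s) k = ∑ j, W j k * (W *ᵥ s) j := by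
        rw [← mulVec_mulVec]; rfl
    _ = (W *ᵥ s) i := by
        rw [Finset.sum_eq_single i (fun j _ hj => by simp [hcol0 j hj]) (by simp), hi, one_mul]
    _ = ∑ l ∈ {k, σ k}, W i l * s l :=
        (Finset.sum_subset (Finset.subset_univ _) fun l _ hl => by simp [hrow0 l hl]).symm
    _ = s k + s (σ k) := by rw [Finset.sum_pair (hσ k).symm, hi, hi', one_mul, one_mul]

/-- **End-to-end decoding correctness (eq. (25) of the paper).**
For `K = 2M`, a fixed-point-free involution `σ` on `Fin K`, a 0/1 pairing
matrix `W` (columns summing to 1, rows summing to 2, `W m k = W m (σ k)`), and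
any invertible real `M × M` matrix `A`, user `k` subtracting its own codeword
from `((Wᵀ A⁻¹)(A W)) s` recovers its partner's codeword:
`((Wᵀ·A⁻¹)·(A·W)·s)ₖ − sₖ = s_{σ(k)}`. -/
theorem endToEnd_decoding_correct
    (M : ℕ) (hM : 0 < M) (K : ℕ) (hK : K = 2 * M)
    (σ : Fin K → Fin K) (hσ : σ ∘ σ = id) (hσfp : ∀ k, σ k ≠ k)
    (W : Matrix (Fin M) (Fin K) ℝ)
    (hW01 : ∀ m k, W m k = 0 ∨ W m k = 1)
    (hcol : ∀ k, ∑ m, W m k = 1)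
    (hrow : ∀ m, ∑ k, W m k = 2)
    (hpair : ∀ m k, W m k = W m (σ k))
    (A : Matrix (Fin M) (Fin M) ℝ) (hA : IsUnit A) :
    ∀ (s : Fin K → ℝ) (k : Fin K),
      ((W.transpose * A⁻¹) * (A * W)).mulVec s k - s k = s (σ k) := by
  intro s k
  have hmul : (W.transpose * A⁻¹) * (A * W) = W.transpose * W := by
    rw [Matrix.mul_assoc,
      Matrix.nonsing_inv_mul_cancel_left A W ((Matrix.isUnit_iff_isUnit_det A).1 hA)]
  rw [hmul, transpose_mul_self_mulVec_of_pairing hσfp hW01 hcol hrow hpair, add_sub_cancel_left]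
end
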